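/- (Generalized Plücker relation.) Let Φ be an N×L complex matrix, let 0 ≤ k ≤ N − 1, and let E, F, S ⊆ {1,…,L} with |E| = k, |F| = N − k − 1 and |S| = N + 1. Then Σ over subsets C ⊆ S with |C| = N − k, setting D = S \ C, of sgn(C, D) · det(Φ_{E ⌢ C}) · det(Φ_{D ⌢ F}) = 0, where E ⌢ C denotes the list consisting of the increasing enumeration of E followed by the increasing enumeration of C (and similarly D ⌢ F), and a determinant with a repeated column index is zero. -/

import Mathlib

open Matrix

/-- The `N × N` matrix whose `m`-th column is the column of `Φ` indexed by the
`m`-th entry of the list `lst` (columns beyond the length of the list are padded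
with zeros; no padding occurs when `lst` has length `N`).  A repeated column
index yields a repeated column, hence a vanishing determinant. -/
def listMat {N L : ℕ} (Φ : Matrix (Fin N) (Fin L) ℂ) (lst : List (Fin L)) :
    Matrix (Fin N) (Fin N) ℂ :=
  fun i m => if h : (m : ℕ) < lst.length then Φ i (lst.get ⟨m, h⟩) else 0

/-- For disjoint finite sets `C`, `D`, the sign `(−1)^m` where
`m = #{(c,d) ∈ C × D : c > d}`, i.e. the sign of the permutation sorting the
concatenation of the increasing enumerations of `C` and `D`. -/
def pairSgn {L : ℕ} (C D : Finset (Fin L)) : ℂ :=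
  (-1) ^ ((C ×ˢ D).filter (fun p => p.2 < p.1)).card

open Equiv

/-- Fixing the first block of arguments of an alternating map leaves an alternating map in the
second block. -/
def AlternatingMap.sumElimLeft {ι κ V : Type*} [AddCommGroup V] [Module ℂ V]
    (A : V [⋀^ι ⊕ κ]→ₗ[ℂ] ℂ) (e : ι → V) : V [⋀^κ]→ₗ[ℂ] ℂ where
  toFun x := A (Sum.elim e x)
  map_update_add' x i y z := by
    classical
    simp only [Sum.elim_update_right, A.map_update_add]
  map_update_smul' x i c y := by
    classical
    simp only [Sum.elim_update_right, A.map_update_smul]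
  map_eq_zero_of_eq' x i j h hij :=
    A.map_eq_zero_of_eq (i := Sum.inr i) (j := Sum.inr j) _ (by simpa using h) (by simpa using hij)

theorem pairSgn_eq_prod {a b L : ℕ} {C D : Finset (Fin L)} (hC : C.card = a) (hD : D.card = b) :
    pairSgn C D =
      ∏ i, ∏ j, if D.orderEmbOfFin hD j < C.orderEmbOfFin hC i then (-1 : ℂ) else 1 := by
  rw [pairSgn, ← Finset.prod_const, Finset.prod_filter, Finset.prod_product]
  conv_lhs => rw [← C.map_orderEmbOfFin_univ hC, ← D.map_orderEmbOfFin_univ hD]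
  simp only [Finset.prod_map, RelEmbedding.coe_toEmbedding]

theorem pairSgn_map {m L : ℕ} (u : Fin m ↪o Fin L) (C D : Finset (Fin m)) :
    pairSgn (C.map u.toEmbedding) (D.map u.toEmbedding) = pairSgn C D := by
  simp only [pairSgn, ← Finset.prod_const, Finset.prod_filter, Finset.prod_product,
    Finset.prod_map, RelEmbedding.coe_toEmbedding, OrderEmbedding.lt_iff_lt]

theorem sign_finSumEquivOfFinset {a b : ℕ} {C : Finset (Fin (a + b))} (hC : C.card = a)
    (hD : Cᶜ.card = b) :
    ((Perm.sign (finSumFinEquiv.symm.trans (finSumEquivOfFinset hC hD)) : ℤ) : ℂ) =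
      pairSgn C Cᶜ := by
  rw [pairSgn_eq_prod hC hD, Perm.sign_eq_prod_prod_Ioi]
  set σ := finSumFinEquiv.symm.trans (finSumEquivOfFinset hC hD) with hσ
  have hl (i : Fin a) : σ (Fin.castAdd b i) = C.orderEmbOfFin hC i := by simp [hσ]
  have hr (j : Fin b) : σ (Fin.natAdd a j) = Cᶜ.orderEmbOfFin hD j := by simp [hσ]
  have h (i : Fin (a + b)) : Finset.Ioi i = Finset.univ.filter (i < ·) := by ext; simp
  have hlt (i : Fin a) (j : Fin b) : Fin.castAdd b i < Fin.natAdd a j := by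
    rw [Fin.lt_def, Fin.val_castAdd, Fin.val_natAdd]; omega
  have hne (i : Fin a) (j : Fin b) : C.orderEmbOfFin hC i ≠ Cᶜ.orderEmbOfFin hD j := by
    intro e
    have := Cᶜ.orderEmbOfFin_mem hD j
    rw [← e, Finset.mem_compl] at this
    exact this (C.orderEmbOfFin_mem hC i)
  have hll (i j : Fin a) : Fin.castAdd b i < Fin.castAdd b j ↔ i < j := Iff.rfl
  have hrr (i j : Fin b) : Fin.natAdd a i < Fin.natAdd a j ↔ i < j := by
    rw [Fin.lt_def, Fin.lt_def, Fin.val_natAdd, Fin.val_natAdd]; omega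
  simp only [h, Finset.prod_filter, Fin.prod_univ_add, hl, hr, OrderEmbedding.lt_iff_lt, hlt,
    (hlt _ _).not_gt, hll, hrr, if_true, if_false]
  have h1 (p : Prop) [Decidable p] : (if p then if p then (1 : ℤˣ) else -1 else 1) = 1 := by
    split_ifs <;> rfl
  simp only [h1, Finset.prod_const_one, one_mul, mul_one, Units.coe_prod, Int.cast_prod]
  refine Finset.prod_congr rfl fun i _ => Finset.prod_congr rfl fun j _ => ?_
  rcases lt_or_gt_of_ne (hne i j) with h | h
  · simp [h, h.not_gt]
  · simp [h, h.not_gt]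

theorem sum_powersetCard_univ_eq_zero {V : Type*} [AddCommGroup V] [Module ℂ V]
    [FiniteDimensional ℂ V] {a b : ℕ} (hV : Module.finrank ℂ V < a + b)
    (f : V [⋀^Fin a]→ₗ[ℂ] ℂ) (g : V [⋀^Fin b]→ₗ[ℂ] ℂ) (v : Fin (a + b) → V)
    {P Q : Finset (Fin (a + b)) → ℂ}
    (hP : ∀ C (h : C.card = a), P C = f (v ∘ C.orderEmbOfFin h))
    (hQ : ∀ D (h : D.card = b), Q D = g (v ∘ D.orderEmbOfFin h)) :
    ∑ C ∈ Finset.univ.powersetCard a, pairSgn C Cᶜ * P C * Q Cᶜ = 0 := by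
  let T (σ : Perm (Fin a ⊕ Fin b)) : ℂ := ((Perm.sign σ : ℤ) : ℂ) *
    (f (fun i => v (finSumFinEquiv (σ (.inl i)))) * g (fun j => v (finSumFinEquiv (σ (.inr j)))))
  have hsum : ∑ σ, T σ = 0 := by
    let M : MultilinearMap ℂ (fun _ : Fin a ⊕ Fin b => V) ℂ :=
      (LinearMap.mul' ℂ ℂ).compMultilinearMap
        (MultilinearMap.domCoprod f.toMultilinearMap g.toMultilinearMap)
    have h0 : MultilinearMap.alternatization M (v ∘ finSumFinEquiv) = 0 := by
      refine AlternatingMap.map_linearDependent _ _ fun h => ?_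
      have := h.fintype_card_le_finrank
      simp at this
      omega
    rw [MultilinearMap.alternatization_apply] at h0
    rw [← h0]
    refine Finset.sum_congr rfl fun σ _ => ?_
    simp [T, M, Units.smul_def]
  let K (σ : Perm (Fin a ⊕ Fin b)) : Finset (Fin (a + b)) :=
    Finset.univ.map ⟨fun i : Fin a => finSumFinEquiv (σ (.inl i)), fun i j h => by simpa using h⟩
  have hT (σ : Perm (Fin a ⊕ Fin b)) (s : Perm (Fin a)) (t : Perm (Fin b)) :
      T (σ * Perm.sumCongr s t) = T σ := by
    have hf := f.map_perm (fun i => v (finSumFinEquiv (σ (.inl i)))) s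
    have hg := g.map_perm (fun i => v (finSumFinEquiv (σ (.inr i)))) t
    simp only [Function.comp_def] at hf hg
    simp only [T, Perm.mul_apply, Perm.sumCongr_apply, Sum.map_inl, Sum.map_inr, hf, hg,
      Perm.sign_mul, Perm.sign_sumCongr]
    rcases Int.units_eq_one_or (Perm.sign s) with h | h <;>
      rcases Int.units_eq_one_or (Perm.sign t) with h' | h' <;> simp [h, h']
  classical
  let H : Finset (Perm (Fin a ⊕ Fin b)) :=
    Finset.univ.filter (· ∈ (Perm.sumCongrHom (Fin a) (Fin b)).range)
  have hH : (H.card : ℂ) ≠ 0 := by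
    have : (1 : Perm (Fin a ⊕ Fin b)) ∈ H := Finset.mem_filter.2 ⟨Finset.mem_univ _, one_mem _⟩
    exact_mod_cast (Finset.card_pos.2 ⟨_, this⟩).ne'
  have hK : ∀ σ ∈ Finset.univ, K σ ∈ Finset.univ.powersetCard a := by simp [K]
  rw [← Finset.sum_fiberwise_of_maps_to hK] at hsum
  refine (mul_eq_zero.1 (Eq.trans ?_ hsum)).resolve_left hH
  rw [Finset.mul_sum]
  refine Finset.sum_congr rfl fun C hC => ?_
  have hCa : C.card = a := (Finset.mem_powersetCard.1 hC).2
  have hCb : Cᶜ.card = b := by rw [Finset.card_compl, Fintype.card_fin, hCa]; omega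
  let σ : Perm (Fin a ⊕ Fin b) := (finSumEquivOfFinset hCa hCb).trans finSumFinEquiv.symm
  have hσ : T σ = pairSgn C Cᶜ * P C * Q Cᶜ := by
    have : Perm.sign σ =
        Perm.sign (finSumFinEquiv.symm.trans (finSumEquivOfFinset hCa hCb)) := by
      rw [← Perm.sign_permCongr finSumFinEquiv σ]
      congr 1
      ext x
      simp [σ, Equiv.permCongr_apply]
    simp only [T, this, sign_finSumEquivOfFinset, hP C hCa, hQ Cᶜ hCb]
    simp [σ, Function.comp_def, mul_assoc]
  have hKmem (τ : Perm (Fin a ⊕ Fin b)) : K τ = C ↔ σ⁻¹ * τ ∈ H := by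
    have hmem (y : Fin a ⊕ Fin b) : finSumFinEquiv y ∈ C ↔ ∃ i, σ (.inl i) = y := by
      rw [← Finset.mem_coe, ← C.range_orderEmbOfFin hCa, Set.mem_range]
      simp only [σ, Equiv.trans_apply, finSumEquivOfFinset_inl, Equiv.symm_apply_eq]
    constructor
    · intro h
      refine Finset.mem_filter.2 ⟨Finset.mem_univ _,
        Perm.mem_sumCongrHom_range_of_perm_mapsTo_inl ?_⟩
      rintro _ ⟨i, rfl⟩
      have hi : finSumFinEquiv (τ (.inl i)) ∈ C := h ▸ Finset.mem_map_of_mem _ (Finset.mem_univ i)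
      obtain ⟨j, hj⟩ := (hmem _).1 hi
      exact ⟨j, by rw [Perm.mul_apply, ← hj, Perm.inv_def, Equiv.symm_apply_apply]⟩
    · intro h
      obtain ⟨⟨s, t⟩, hst⟩ := (Finset.mem_filter.1 h).2
      refine Finset.eq_of_subset_of_card_le (fun x hx => ?_) (by simp [K, hCa])
      obtain ⟨i, -, rfl⟩ := Finset.mem_map.1 hx
      refine (hmem _).2 ⟨s i, ?_⟩
      rw [eq_inv_mul_iff_mul_eq] at hst
      rw [← hst]
      rfl
  rw [← hσ, ← nsmul_eq_mul, ← Finset.sum_const]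
  refine Finset.sum_bij (fun ρ _ => σ * ρ) ?_ ?_ ?_ ?_
  · intro ρ hρ
    simpa [hKmem] using hρ
  · intro ρ _ ρ' _ h
    exact mul_left_cancel h
  · intro τ hτ
    exact ⟨σ⁻¹ * τ, (hKmem τ).1 (Finset.mem_filter.1 hτ).2, by simp⟩
  · intro ρ hρ
    obtain ⟨⟨s, t⟩, rfl⟩ := (Finset.mem_filter.1 hρ).2
    exact (hT σ s t).symm

theorem sum_powersetCard_eq_zero {V : Type*} [AddCommGroup V] [Module ℂ V]
    [FiniteDimensional ℂ V] {a b L : ℕ} (hV : Module.finrank ℂ V < a + b)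
    (f : V [⋀^Fin a]→ₗ[ℂ] ℂ) (g : V [⋀^Fin b]→ₗ[ℂ] ℂ) (v : Fin L → V)
    {P Q : Finset (Fin L) → ℂ}
    (hP : ∀ C (h : C.card = a), P C = f (v ∘ C.orderEmbOfFin h))
    (hQ : ∀ D (h : D.card = b), Q D = g (v ∘ D.orderEmbOfFin h))
    {S : Finset (Fin L)} (hS : S.card = a + b) :
    ∑ C ∈ S.powersetCard a, pairSgn C (S \ C) * P C * Q (S \ C) = 0 := by
  let u := S.orderEmbOfFin hS
  have hu : Finset.univ.map u.toEmbedding = S := S.map_orderEmbOfFin_univ hS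
  have hmap {m : ℕ} (C : Finset (Fin (a + b))) (h : C.card = m)
      (h' : (C.map u.toEmbedding).card = m) :
      v ∘ (C.map u.toEmbedding).orderEmbOfFin h' = (v ∘ u) ∘ C.orderEmbOfFin h := by
    rw [Function.comp_assoc]
    congr 1
    refine (Finset.orderEmbOfFin_unique h' (fun x => ?_) ?_).symm
    · exact Finset.mem_map_of_mem _ (C.orderEmbOfFin_mem h x)
    · exact u.strictMono.comp (C.orderEmbOfFin h).strictMono
  have key := sum_powersetCard_univ_eq_zero hV f g (v ∘ u)
    (P := fun C => P (C.map u.toEmbedding)) (Q := fun D => Q (D.map u.toEmbedding))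
    (fun C h => by rw [hP _ (by simpa using h), hmap C h])
    (fun D h => by rw [hQ _ (by simpa using h), hmap D h])
  rw [← hu, Finset.powersetCard_map, Finset.sum_map, ← key]
  refine Finset.sum_congr rfl fun C _ => ?_
  simp [Finset.mapEmbedding_apply, ← Finset.map_sdiff, pairSgn_map, Finset.compl_eq_univ_sdiff]

/-- The determinant of the columns of `Φ` listed by `C` and then `D`, as a determinant of the
rows indexed by a sum type. -/
theorem det_listMat_sort_append {N L a b : ℕ} (Φ : Matrix (Fin N) (Fin L) ℂ)
    {C D : Finset (Fin L)} (hC : C.card = a) (hD : D.card = b) (h : a + b = N) :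
    (listMat Φ (C.sort (· ≤ ·) ++ D.sort (· ≤ ·))).det =
      (Matrix.detRowAlternating.domDomCongr
        ((finCongr h).symm.trans finSumFinEquiv.symm) : (Fin N → ℂ) [⋀^Fin a ⊕ Fin b]→ₗ[ℂ] ℂ)
        (Sum.elim (Φ.col ∘ C.orderEmbOfFin hC) (Φ.col ∘ D.orderEmbOfFin hD)) := by
  subst h
  rw [← Matrix.det_transpose, AlternatingMap.domDomCongr_apply]
  change _ = Matrix.det _
  congr 1
  ext m i
  induction m using Fin.addCases with
  | left m => simp [listMat, hC, hD, Finset.orderEmbOfFin_apply]; omega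
  | right m => simp [listMat, hC, hD, Finset.orderEmbOfFin_apply]

/-- generalized Plücker relation: for `|E| = k`,
`|F| = N − k − 1`, `|S| = N + 1` (with `0 ≤ k ≤ N − 1`),
`Σ_{C ⊆ S, |C| = N−k, D = S \ C} sgn(C, D) · det(Φ_{E ⌢ C}) · det(Φ_{D ⌢ F}) = 0`. -/
theorem generalized_plucker {N L k : ℕ} (Φ : Matrix (Fin N) (Fin L) ℂ)
    (hk : k + 1 ≤ N) (E F S : Finset (Fin L))
    (hE : E.card = k) (hF : F.card + (k + 1) = N) (hS : S.card = N + 1) :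
    ∑ C ∈ S.powersetCard (N - k),
      pairSgn C (S \ C) *
        (listMat Φ (E.sort (· ≤ ·) ++ C.sort (· ≤ ·))).det *
        (listMat Φ ((S \ C).sort (· ≤ ·) ++ F.sort (· ≤ ·))).det
      = 0 := by
  have hS' : S.card = (N - k) + (k + 1) := by omega
  refine sum_powersetCard_eq_zero (V := Fin N → ℂ) (by simp; omega)
    (AlternatingMap.sumElimLeft (Matrix.detRowAlternating.domDomCongr
      ((finCongr (by omega : k + (N - k) = N)).symm.trans finSumFinEquiv.symm))
      (Φ.col ∘ E.orderEmbOfFin hE))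
    (AlternatingMap.sumElimLeft ((Matrix.detRowAlternating.domDomCongr
      ((finCongr (by omega : (k + 1) + F.card = N)).symm.trans finSumFinEquiv.symm)).domDomCongr
        (Equiv.sumComm _ _))
      (Φ.col ∘ F.orderEmbOfFin rfl))
    Φ.col
    (P := fun C => (listMat Φ (E.sort (· ≤ ·) ++ C.sort (· ≤ ·))).det)
    (Q := fun D => (listMat Φ (D.sort (· ≤ ·) ++ F.sort (· ≤ ·))).det) ?_ ?_ hS'
  · intro C hC
    exact det_listMat_sort_append Φ hE hC _
  · intro D hD
    refine (det_listMat_sort_append Φ hD rfl (by omega)).trans ?_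
    refine congrArg (AlternatingMap.domDomCongr _ _) (funext ?_)
    rintro (i | j) <;> rfl
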